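/- Assume the information sets are partially nested, i.e. i ∈ N̄_i and N̄_j ⊆ N̄_i for every j ∈ N_i, and let Φ_{i,t} be strictly causal policies depending only on the disturbance history ξ_{N̄_i}^{t−1} of the agents in N̄_i. Then the closed-loop network states depend on the disturbance realization only through the disturbances of the agents in N̄_i: for every i and t, if two disturbance realizations ξ, ξ' ∈ Ξ satisfy ξ_j^{t−1} = ξ'_j{}^{t−1} for every j ∈ N̄_i, then x_{i,t}(ξ) = x_{i,t}(ξ'); equivalently, there exist functions χ_{i,t} of the restricted histories ξ_{N̄_i}^{t−1} such that x_{i,t}(ξ) = χ_{i,t}(ξ_{N̄_i}^{t−1}) for every ξ ∈ Ξ. -/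

import Mathlib

open Matrix

/-- Data of a networked linear system with `M` agents and horizon `T`: state, input and
disturbance dimensions `n, m, d`, neighbor sets `nbr`, known initial states `xInit`, dynamics
matrices `A, B, D, E` (with `B i t j` the block of `B_{i,t}` acting on the states of neighbor
`j`), disturbance sets `unc i = Ξᵢ`, operational constraint sets `cns i = 𝒪ᵢ` and objective
functions `obj i = Jᵢ`.  Time is `0`-based: stage `k : Fin T` corresponds to time `t = k+1`
of the paper, so that the state trajectory is indexed by `Fin (T+1)`. -/
structure NetSys (M T : ℕ) where
  n : Fin M → ℕ
  m : Fin M → ℕ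
  d : Fin M → ℕ
  nbr : Fin M → Finset (Fin M)
  xInit : ∀ i, Fin (n i) → ℝ
  A : ∀ i, Fin T → Matrix (Fin (n i)) (Fin (n i)) ℝ
  B : ∀ i, Fin T → ∀ j, Matrix (Fin (n i)) (Fin (n j)) ℝ
  D : ∀ i, Fin T → Matrix (Fin (n i)) (Fin (m i)) ℝ
  E : ∀ i, Fin T → Matrix (Fin (n i)) (Fin (d i)) ℝ
  unc : ∀ i, Set (Fin T → Fin (d i) → ℝ)
  cns : ∀ i, Set ((Fin (T+1) → Fin (n i) → ℝ) × (Fin T → Fin (m i) → ℝ))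
  obj : ∀ i, (Fin (T+1) → Fin (n i) → ℝ) → (Fin T → Fin (m i) → ℝ) → ℝ

namespace NetSys

variable {M T : ℕ} (S : NetSys M T)

/-- A disturbance profile for all agents. -/
def Prof : Type := ∀ i, Fin T → Fin (S.d i) → ℝ

/-- Membership of a disturbance profile in `Ξ = Ξ₁ × ⋯ × Ξ_M`. -/
def memUnc (ξ : S.Prof) : Prop := ∀ i, ξ i ∈ S.unc i

/-- The interconnected network closed-loop equations for a given input profile `u`:
`x` is the closed-loop state trajectory profile. -/
def NetTraj (ξ : S.Prof) (u : ∀ i, Fin T → Fin (S.m i) → ℝ)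
    (x : ∀ i, Fin (T+1) → Fin (S.n i) → ℝ) : Prop :=
  ∀ i, x i 0 = S.xInit i ∧
    ∀ k : Fin T,
      x i k.succ =
        S.A i k *ᵥ x i k.castSucc +
        (∑ j ∈ (S.nbr i).attach, S.B i k j.1 *ᵥ x j.1 k.castSucc) +
        S.D i k *ᵥ u i k + S.E i k *ᵥ ξ i k


end NetSys

/-- Under a partially nested information structure, closed-loop trajectories under strictly
causal policies agree at agent `i` and time `t` as soon as the disturbance histories of the
agents in `Nb i` agree before time `t`. -/
theorem NetSys.NetTraj.state_eq_of_history_eq {M T : ℕ} {S : NetSys M T}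
    {Nb : Fin M → Finset (Fin M)} (hself : ∀ i, i ∈ Nb i)
    (hnested : ∀ i, ∀ j ∈ S.nbr i, Nb j ⊆ Nb i)
    {Φ : ∀ i, Fin T → S.Prof → Fin (S.m i) → ℝ}
    (hΦ : ∀ i (k : Fin T) (ξ ξ' : S.Prof),
      (∀ j ∈ Nb i, ∀ s : Fin T, (s : ℕ) < (k : ℕ) → ξ j s = ξ' j s) →
      Φ i k ξ = Φ i k ξ')
    {ξ ξ' : S.Prof} {x x' : ∀ i, Fin (T+1) → Fin (S.n i) → ℝ}
    (hx : S.NetTraj ξ (fun i k => Φ i k ξ) x) (hx' : S.NetTraj ξ' (fun i k => Φ i k ξ') x')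
    (t : Fin (T+1)) (i : Fin M)
    (hξ : ∀ j ∈ Nb i, ∀ s : Fin T, (s : ℕ) < (t : ℕ) → ξ j s = ξ' j s) :
    x i t = x' i t := by
  induction t using Fin.induction generalizing i with
  | zero => rw [(hx i).1, (hx' i).1]
  | succ k ih =>
    have hpast : ∀ j ∈ Nb i, ∀ s : Fin T, (s : ℕ) < (k : ℕ) → ξ j s = ξ' j s :=
      fun j hj s hs => hξ j hj s (by rw [Fin.val_succ]; omega)
    have hnbr : ∀ j ∈ (S.nbr i).attach,
        S.B i k j.1 *ᵥ x j.1 k.castSucc = S.B i k j.1 *ᵥ x' j.1 k.castSucc := fun j _ => by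
      rw [ih j.1 fun l hl s hs => hpast l (hnested i j.1 j.2 hl) s hs]
    refine ((hx i).2 k).trans (Eq.trans ?_ ((hx' i).2 k).symm)
    exact congrArg₂ (· + ·) (congrArg₂ (· + ·) (congrArg₂ (· + ·)
      (congrArg (S.A i k *ᵥ ·) (ih i hpast)) (Finset.sum_congr rfl hnbr))
      (congrArg (S.D i k *ᵥ ·) (hΦ i k ξ ξ' hpast)))
      (congrArg (S.E i k *ᵥ ·) (hξ i (hself i) k (by simp)))

/-- closed-loop representation (A.1) in the proof of Theorem 1: under a
partially nested information structure and strictly causal policies `Φᵢ` depending only on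
the disturbances of the agents in `N̄ᵢ`, the closed-loop state of agent `i` at time `t`
depends on the disturbance realization only through the history `ξ_{N̄ᵢ}` up to time `t−1`;
equivalently, there are functions `χ` of the restricted histories representing the
closed-loop states. -/
theorem stmt13 {M T : ℕ} (S : NetSys M T)
    (hne : ∀ i, (S.unc i).Nonempty)
    (Nb : Fin M → Finset (Fin M))
    (hNb1 : ∀ i, i ∈ Nb i)
    (hNb2 : ∀ i, ∀ j ∈ S.nbr i, Nb j ⊆ Nb i)
    (Φ : ∀ i, Fin T → S.Prof → Fin (S.m i) → ℝ)
    (hΦ : ∀ i (k : Fin T) (ξ ξ' : S.Prof),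
      (∀ j ∈ Nb i, ∀ s : Fin T, (s : ℕ) < (k : ℕ) → ξ j s = ξ' j s) →
      Φ i k ξ = Φ i k ξ') :
    (∀ (i : Fin M) (t : Fin (T+1)) (ξ ξ' : S.Prof), S.memUnc ξ → S.memUnc ξ' →
      (∀ j ∈ Nb i, ∀ s : Fin T, (s : ℕ) < (t : ℕ) → ξ j s = ξ' j s) →
      ∀ x x', S.NetTraj ξ (fun i k => Φ i k ξ) x →
        S.NetTraj ξ' (fun i k => Φ i k ξ') x' →
        x i t = x' i t) ∧
    ∃ χ : ∀ i : Fin M, Fin (T+1) →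
        (((j : {j // j ∈ Nb i}) → Fin T → Fin (S.d j.1) → ℝ) → Fin (S.n i) → ℝ),
      ∀ (i : Fin M) (t : Fin (T+1)),
        (∀ (η η' : (j : {j // j ∈ Nb i}) → Fin T → Fin (S.d j.1) → ℝ),
          (∀ j (s : Fin T), (s : ℕ) < (t : ℕ) → η j s = η' j s) →
          χ i t η = χ i t η') ∧
        ∀ ξ, S.memUnc ξ → ∀ x, S.NetTraj ξ (fun i k => Φ i k ξ) x →
          x i t = χ i t (fun j => ξ j.1) := by
  refine ⟨fun i t ξ ξ' _ _ hξ x x' hx hx' => hx.state_eq_of_history_eq hNb1 hNb2 hΦ hx' t i hξ,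
    fun i t η => Classical.epsilon fun v => ∃ (ξ : S.Prof) (x : _),
      (∀ j : {j // j ∈ Nb i}, ∀ s : Fin T, (s : ℕ) < (t : ℕ) → ξ j.1 s = η j s) ∧
        S.NetTraj ξ (fun i k => Φ i k ξ) x ∧ x i t = v,
    fun i t => ⟨fun η η' hη => ?_, fun ξ _ x hx => ?_⟩⟩
  · have hiff : ∀ ξ : S.Prof,
        (∀ j : {j // j ∈ Nb i}, ∀ s : Fin T, (s : ℕ) < (t : ℕ) → ξ j.1 s = η j s) ↔
          ∀ j : {j // j ∈ Nb i}, ∀ s : Fin T, (s : ℕ) < (t : ℕ) → ξ j.1 s = η' j s :=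
      fun ξ => forall₃_congr fun j s hs => by rw [hη j s hs]
    simp only [hiff]
  · obtain ⟨ξ', x', hξ', hx', hv⟩ := Classical.epsilon_spec
      (p := fun v => ∃ (ξ' : S.Prof) (x' : _),
        (∀ j : {j // j ∈ Nb i}, ∀ s : Fin T, (s : ℕ) < (t : ℕ) → ξ' j.1 s = ξ j.1 s) ∧
          S.NetTraj ξ' (fun i k => Φ i k ξ') x' ∧ x' i t = v)
      ⟨x i t, ξ, x, fun _ _ _ => rfl, hx, rfl⟩
    exact (hx.state_eq_of_history_eq hNb1 hNb2 hΦ hx' t i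
      fun j hj s hs => (hξ' ⟨j, hj⟩ s hs).symm).trans hv
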